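/- arXiv:2211.06245 — 2 statements merged into one kernel-verified Lean document; each statement's English description precedes it below -/
import Mathlib

section
/- For every n ≥ 5, the 3-uniform hypergraph H = (V, E) with V = {1,...,n} and E = { {i, i+1, i+2} : i ∈ {1,...,n} } (indices mod n) is 3-regular and satisfies EI(H) = C_n; in particular its number of hyperedges is n, which is minimum among all 3-uniform hypergraphs whose edge intersection hypergraph is C_n. -/
open Finset

/-- Edge intersection hypergraph of a hypergraph with edge set `E` on vertex set `Fin n`. -/
def EIh {n : ℕ} (E : Finset (Finset (Fin n))) : Finset (Finset (Fin n)) :=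
  ((E ×ˢ E).filter fun p => p.1 ≠ p.2 ∧ 2 ≤ (p.1 ∩ p.2).card).image fun p => p.1 ∩ p.2

/-- The edge set of the cycle `C_n` on vertex set `Fin n`. -/
def cyc (n : ℕ) [NeZero n] : Finset (Finset (Fin n)) :=
  Finset.univ.image fun i : Fin n => ({i, i + 1} : Finset (Fin n))

/-- Degree of a vertex in a hypergraph. -/
def hdeg {n : ℕ} (E : Finset (Finset (Fin n))) (v : Fin n) : ℕ :=
  (E.filter fun e => v ∈ e).card

/-- Three cyclically consecutive vertices. -/
def consecutiveTriple {n : ℕ} [NeZero n] (i : Fin n) : Finset (Fin n) := {i, i + 1, i + 2}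

lemma Fin.ofNat_ne_zero_of_lt {n : ℕ} [NeZero n] {k : ℕ} (hk : 0 < k) (h : k < n) :
    Fin.ofNat n k ≠ 0 := by
  intro h0
  have := congrArg Fin.val h0
  simp [Fin.ofNat, Nat.mod_eq_of_lt h] at this
  omega

/-- `1` and `2` in `Fin n`, written through a single generic element of additive order at
least five. -/
lemma Fin.exists_step {n : ℕ} [NeZero n] (hn : 5 ≤ n) :
    ∃ u : Fin n, 1 = u ∧ 2 = u + u ∧ u ≠ 0 ∧ u + u ≠ 0 ∧ u + u + u ≠ 0 ∧ u + u + u + u ≠ 0 := by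
  have h2 : (2 : Fin n) = 1 + 1 := by grind
  have h3 : (3 : Fin n) = 1 + 1 + 1 := by grind
  have h4 : (4 : Fin n) = 1 + 1 + 1 + 1 := by grind
  refine ⟨1, rfl, h2, ?_⟩
  rw [← h4, ← h3, ← h2]
  exact ⟨ofNat_ne_zero_of_lt (k := 1) (by omega) (by omega),
    ofNat_ne_zero_of_lt (k := 2) (by omega) (by omega),
    ofNat_ne_zero_of_lt (k := 3) (by omega) (by omega),
    ofNat_ne_zero_of_lt (k := 4) (by omega) (by omega)⟩

lemma mem_EIh {n : ℕ} {E : Finset (Finset (Fin n))} {s : Finset (Fin n)} :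
    s ∈ EIh E ↔ ∃ e ∈ E, ∃ f ∈ E, e ≠ f ∧ 2 ≤ (e ∩ f).card ∧ e ∩ f = s := by
  simp only [EIh, mem_image, mem_filter, mem_product, Prod.exists]
  grind

section

variable {n : ℕ} [NeZero n]

lemma mem_consecutiveTriple {i x : Fin n} :
    x ∈ consecutiveTriple i ↔ x = i ∨ x = i + 1 ∨ x = i + 2 := by
  simp [consecutiveTriple]

lemma card_consecutiveTriple (hn : 5 ≤ n) (i : Fin n) : (consecutiveTriple i).card = 3 := by
  obtain ⟨u, e1, e2, h1, h2, h3, h4⟩ := Fin.exists_step hn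
  simp only [consecutiveTriple, e1, e2]
  exact card_eq_three.2 ⟨i, i + u, i + (u + u), by grind -lia, by grind -lia, by grind -lia, rfl⟩

lemma consecutiveTriple_injective (hn : 5 ≤ n) :
    Function.Injective (consecutiveTriple (n := n)) := by
  obtain ⟨u, e1, e2, h1, h2, h3, h4⟩ := Fin.exists_step hn
  intro i j h
  have key (x : Fin n) (hx : x ∈ consecutiveTriple i) : x = j ∨ x = j + 1 ∨ x = j + 2 :=
    mem_consecutiveTriple.1 (h ▸ hx)
  simp only [e1, e2] at key
  have ha := key i (by simp [mem_consecutiveTriple, e1, e2])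
  have hb := key (i + u) (by simp [mem_consecutiveTriple, e1, e2])
  have hc := key (i + (u + u)) (by simp [mem_consecutiveTriple, e1, e2])
  grind -lia

lemma consecutiveTriple_inter_succ (hn : 5 ≤ n) (i : Fin n) :
    consecutiveTriple i ∩ consecutiveTriple (i + 1) = {i + 1, i + 1 + 1} := by
  obtain ⟨u, e1, e2, h1, h2, h3, h4⟩ := Fin.exists_step hn
  ext x
  simp only [mem_inter, mem_consecutiveTriple, mem_insert, mem_singleton, e1, e2]
  grind -lia

lemma eq_succ_or_eq_succ_of_two_le_card_inter (hn : 5 ≤ n) {i j : Fin n} (hij : i ≠ j)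
    (h : 2 ≤ (consecutiveTriple i ∩ consecutiveTriple j).card) : j = i + 1 ∨ i = j + 1 := by
  obtain ⟨u, e1, e2, h1, h2, h3, h4⟩ := Fin.exists_step hn
  obtain ⟨x, hx, y, hy, hxy⟩ := one_lt_card.1 h
  simp only [mem_inter, mem_consecutiveTriple, e1, e2] at hx hy ⊢
  obtain ⟨hx, hx'⟩ := hx
  obtain ⟨hy, hy'⟩ := hy
  rcases hx with rfl | rfl | rfl <;> rcases hy with rfl | rfl | rfl <;> grind -lia

lemma card_pair_succ (hn : 5 ≤ n) (i : Fin n) : ({i, i + 1} : Finset (Fin n)).card = 2 := by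
  obtain ⟨u, e1, e2, h1, h2, h3, h4⟩ := Fin.exists_step hn
  rw [e1]
  exact card_pair (by grind -lia)

lemma EIh_consecutiveTriple (hn : 5 ≤ n) :
    EIh (univ.image (consecutiveTriple (n := n))) = cyc n := by
  obtain ⟨u, e1, e2, h1, h2, h3, h4⟩ := Fin.exists_step hn
  ext s
  rw [mem_EIh]
  simp only [cyc, mem_image, mem_univ, true_and, exists_exists_eq_and]
  constructor
  · rintro ⟨i, j, hne, hcard, rfl⟩
    rcases eq_succ_or_eq_succ_of_two_le_card_inter hn (ne_of_apply_ne _ hne) hcard with rfl | rfl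
    · exact ⟨i + 1, (consecutiveTriple_inter_succ hn i).symm⟩
    · exact ⟨j + 1, by rw [inter_comm, consecutiveTriple_inter_succ hn]⟩
  · rintro ⟨i, rfl⟩
    have h := consecutiveTriple_inter_succ hn (i - 1)
    rw [sub_add_cancel] at h
    refine ⟨i - 1, i, (consecutiveTriple_injective hn).ne (by rw [e1]; grind -lia), ?_, h⟩
    rw [h, card_pair_succ hn]

lemma hdeg_consecutiveTriple (hn : 5 ≤ n) (v : Fin n) :
    hdeg (univ.image (consecutiveTriple (n := n))) v = 3 := by
  obtain ⟨u, e1, e2, h1, h2, h3, h4⟩ := Fin.exists_step hn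
  rw [hdeg, filter_image, card_image_of_injective _ (consecutiveTriple_injective hn)]
  refine card_eq_three.2 ⟨v, v - u, v - (u + u), by grind -lia, by grind -lia, by grind -lia, ?_⟩
  ext i
  simp only [mem_filter, mem_univ, true_and, mem_consecutiveTriple, mem_insert, mem_singleton,
    e1, e2]
  grind -lia

/-- A set of three vertices contains at most two edges of the cycle. -/
lemma card_filter_mem_succ_mem_le_two (hn : 5 ≤ n) {e : Finset (Fin n)} (he : e.card = 3) :
    (univ.filter fun i : Fin n => i ∈ e ∧ i + 1 ∈ e).card ≤ 2 := by
  obtain ⟨u, e1, e2, h1, h2, h3, h4⟩ := Fin.exists_step hn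
  simp only [e1]
  by_contra! h
  have heq : (univ.filter fun i : Fin n => i ∈ e ∧ i + u ∈ e) = e :=
    eq_of_subset_of_card_le (fun i hi => (mem_filter.1 hi).2.1) (by omega)
  have hsucc (i : Fin n) (hi : i ∈ e) : i + u ∈ e := by
    rw [← heq] at hi
    exact (mem_filter.1 hi).2.2
  obtain ⟨i, hi⟩ := card_pos.1 (by omega : 0 < e.card)
  have hi1 := hsucc _ hi
  have hi2 := hsucc _ hi1
  have hi3 := hsucc _ hi2
  have hsub : ({i, i + u, i + u + u, i + u + u + u} : Finset (Fin n)) ⊆ e := by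
    simp [insert_subset_iff, *]
  have hcard := card_le_card hsub
  rw [card_insert_of_notMem (by simp only [mem_insert, mem_singleton]; grind -lia),
    card_insert_of_notMem (by simp only [mem_insert, mem_singleton]; grind -lia),
    card_pair (by grind -lia)] at hcard
  omega

lemma le_card_of_EIh_eq_cyc (hn : 5 ≤ n) {E : Finset (Finset (Fin n))}
    (hE : ∀ e ∈ E, e.card = 3) (h : EIh E = cyc n) : n ≤ E.card := by
  have hcount := card_mul_le_card_mul (s := (univ : Finset (Fin n))) (t := E) (m := 2) (n := 2)
    (fun i e => i ∈ e ∧ i + 1 ∈ e) (fun i _ => ?_)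
    (fun e he => card_filter_mem_succ_mem_le_two hn (hE e he))
  · rw [card_univ, Fintype.card_fin] at hcount
    omega
  · have hi : ({i, i + 1} : Finset (Fin n)) ∈ EIh E := h ▸ mem_image_of_mem _ (mem_univ i)
    obtain ⟨e, he, f, hf, hne, -, hef⟩ := mem_EIh.1 hi
    have h0 : i ∈ e ∩ f := by simp [hef]
    have h1 : i + 1 ∈ e ∩ f := by simp [hef]
    rw [mem_inter] at h0 h1
    exact one_lt_card.2 ⟨e, mem_filter.2 ⟨he, h0.1, h1.1⟩, f, mem_filter.2 ⟨hf, h0.2, h1.2⟩, hne⟩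

end

theorem stmt_3 (n : ℕ) [NeZero n] (hn : 5 ≤ n) :
    letI E : Finset (Finset (Fin n)) :=
      Finset.univ.image fun i : Fin n => ({i, i + 1, i + 2} : Finset (Fin n))
    (∀ e ∈ E, e.card = 3) ∧ (∀ v : Fin n, hdeg E v = 3) ∧ EIh E = cyc n ∧
      E.card = n ∧
      (∀ E' : Finset (Finset (Fin n)), (∀ e ∈ E', e.card = 3) → EIh E' = cyc n →
        E.card ≤ E'.card) := by
  have hcard : (univ.image (consecutiveTriple (n := n))).card = n := by
    rw [card_image_of_injective _ (consecutiveTriple_injective hn), card_univ, Fintype.card_fin]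
  refine ⟨?_, hdeg_consecutiveTriple hn, EIh_consecutiveTriple hn, hcard,
    fun E' hE' h => hcard.trans_le (le_card_of_EIh_eq_cyc hn hE' h)⟩
  intro e he
  obtain ⟨i, -, rfl⟩ := mem_image.1 he
  exact card_consecutiveTriple hn i
end

section
/- For every n ≥ 18 there exists a 5-uniform hypergraph H = (V, E) with EI(H) = C_n and |E| = ⌈2n/3⌉ such that all but at most two of the hyperedges of H are (3,2)-hyperedges. -/
open Finset

/-- `e` is a (3,2)-hyperedge: one maximal run of 3 consecutive cycle vertices and one
disjoint maximal run of 2 consecutive cycle vertices. -/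
def IsSection32 {n : ℕ} [NeZero n] (e : Finset (Fin n)) : Prop :=
  ∃ i j : Fin n, e = {i, i + 1, i + 2, j, j + 1} ∧ e.card = 5 ∧
    (i - 1) ∉ e ∧ (i + 3) ∉ e ∧ (j - 1) ∉ e ∧ (j + 2) ∉ e

/-- The cyclic successor of `x` among `0, …, n - 1`. -/
def cycSucc (n x : ℕ) : ℕ := if x + 1 < n then x + 1 else 0

/-- `u` lies on the cyclic run of length three from `a` or on that of length two from `b`. -/
def OnRuns (n a b u : ℕ) : Prop :=
  u = a ∨ u = cycSucc n a ∨ u = cycSucc n (cycSucc n a) ∨ u = b ∨ u = cycSucc n b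

/-- The union of the run of length three from `i` and the run of length two from `j`. -/
def runs {n : ℕ} [NeZero n] (i j : Fin n) : Finset (Fin n) := {i, i + 1, i + 2, j, j + 1}

theorem fin_val_add_one {n : ℕ} [NeZero n] (i : Fin n) :
    (i + 1).val = cycSucc n i.val := by
  have hi := i.isLt
  rw [Fin.val_add, Fin.val_one', Nat.add_mod_mod, cycSucc]
  split_ifs with h
  · exact Nat.mod_eq_of_lt h
  · rw [show i.val + 1 = n by omega, Nat.mod_self]

theorem fin_add_two {n : ℕ} [NeZero n] (i : Fin n) : i + 2 = i + 1 + 1 := by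
  rw [add_assoc]
  congr 1
  ext
  simp [Fin.val_add]

theorem mem_runs {n : ℕ} [NeZero n] (i j u : Fin n) :
    u ∈ runs i j ↔ OnRuns n i.val j.val u.val := by
  simp only [runs, OnRuns, Finset.mem_insert, Finset.mem_singleton, Fin.ext_iff, fin_add_two,
    fin_val_add_one]

theorem runs_card_and_isSection32 {n : ℕ} [NeZero n] (hn : 7 ≤ n) (i j : Fin n)
    (h : i.val + 4 ≤ j.val ∧ j.val + 3 ≤ i.val + n ∨
      j.val + 3 ≤ i.val ∧ i.val + 4 ≤ j.val + n) :
    (runs i j).card = 5 ∧ IsSection32 (runs i j) := by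
  have hi := i.isLt
  have hj := j.isLt
  have hcard : (runs i j).card = 5 := by
    unfold runs
    iterate 4
      rw [Finset.card_insert_of_notMem (by
        simp only [Finset.mem_insert, Finset.mem_singleton, Fin.ext_iff, fin_add_two,
          fin_val_add_one, cycSucc]
        grind)]
    rfl
  have hpred (x y : Fin n) (hx : x - 1 = y) : x.val = cycSucc n y.val := by
    rw [← fin_val_add_one, ← hx, sub_add_cancel]
  have hadd3 : i + 3 = i + 1 + 1 + 1 := by
    rw [add_assoc, add_assoc]
    congr 1
    ext
    simp [Fin.val_add]
  refine ⟨hcard, i, j, rfl, hcard, ?_, ?_, ?_, ?_⟩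
  · have h1 := hpred i _ rfl
    rw [mem_runs]
    unfold OnRuns
    unfold cycSucc at *
    grind
  · rw [mem_runs, hadd3]
    simp only [OnRuns, fin_val_add_one, cycSucc]
    grind
  · have h1 := hpred j _ rfl
    rw [mem_runs]
    unfold OnRuns
    unfold cycSucc at *
    grind
  · rw [mem_runs]
    simp only [fin_add_two, OnRuns, fin_val_add_one, cycSucc]
    grind

/-- A family in which every cycle edge lies in two members and no two members share a pair of
nonadjacent vertices has the cycle as its edge intersection hypergraph. -/
theorem EIh_eq_cyc {n : ℕ} [NeZero n] (hn : 4 ≤ n) (E : Finset (Finset (Fin n)))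
    (hlin : ∀ e ∈ E, ∀ f ∈ E, ∀ u v : Fin n, u.val + 2 ≤ v.val → (u.val = 0 → v.val + 1 < n) →
      u ∈ e → v ∈ e → u ∈ f → v ∈ f → e = f)
    (hcov : ∀ u : Fin n, ∃ e ∈ E, ∃ f ∈ E, e ≠ f ∧ u ∈ e ∧ u + 1 ∈ e ∧ u ∈ f ∧ u + 1 ∈ f) :
    EIh E = cyc n := by
  have hadj : ∀ e ∈ E, ∀ f ∈ E, e ≠ f → ∀ u ∈ e ∩ f, ∀ v ∈ e ∩ f, u ≠ v →
      v = u + 1 ∨ u = v + 1 := by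
    intro e he f hf hef u hu v hv huv
    rw [Finset.mem_inter] at hu hv
    have h1 := hlin e he f hf u v
    have h2 := hlin e he f hf v u
    simp only [Fin.ext_iff, fin_val_add_one, cycSucc, ne_eq] at *
    grind
  have hpair : ∀ e ∈ E, ∀ f ∈ E, e ≠ f → ∀ u ∈ e ∩ f, u + 1 ∈ e ∩ f → e ∩ f = {u, u + 1} := by
    intro e he f hf hef u hu hu1
    ext w
    rw [Finset.mem_insert, Finset.mem_singleton]
    constructor
    · intro hw
      by_contra! hne
      have h1 := hadj e he f hf hef u hu w hw hne.1.symm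
      have h2 := hadj e he f hf hef (u + 1) hu1 w hw hne.2.symm
      simp only [Fin.ext_iff, fin_val_add_one, cycSucc, ne_eq] at h1 h2 hne
      grind
    · rintro (rfl | rfl) <;> assumption
  ext s
  simp only [EIh, cyc, Finset.mem_image, Finset.mem_filter, Finset.mem_product,
    Finset.mem_univ, true_and, Prod.exists]
  constructor
  · rintro ⟨e, f, ⟨⟨he, hf⟩, hef, hcard⟩, rfl⟩
    obtain ⟨u, hu, v, hv, huv⟩ := Finset.one_lt_card.1 hcard
    rcases hadj e he f hf hef u hu v hv huv with rfl | rfl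
    · exact ⟨u, (hpair e he f hf hef u hu hv).symm⟩
    · exact ⟨v, (hpair e he f hf hef v hv hu).symm⟩
  · rintro ⟨u, rfl⟩
    obtain ⟨e, he, f, hf, hef, h1, h2, h3, h4⟩ := hcov u
    have hs := hpair e he f hf hef u (Finset.mem_inter.2 ⟨h1, h3⟩) (Finset.mem_inter.2 ⟨h2, h4⟩)
    refine ⟨e, f, ⟨⟨he, hf⟩, hef, ?_⟩, hs⟩
    rw [hs, Finset.card_pair]
    simp only [ne_eq, Fin.ext_iff, fin_val_add_one, cycSucc]
    grind

theorem exists_of_runs {n : ℕ} [NeZero n] (hn : 7 ≤ n) {ι : Type*} [Fintype ι]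
    (a b : ι → ℕ) (ha : ∀ i, a i < n) (hb : ∀ i, b i < n)
    (hgap : ∀ i, a i + 4 ≤ b i ∧ b i + 3 ≤ a i + n ∨ b i + 3 ≤ a i ∧ a i + 4 ≤ b i + n)
    (hlin : ∀ i j u v, u + 2 ≤ v → v < n → (u = 0 → v + 1 < n) →
      OnRuns n (a i) (b i) u → OnRuns n (a i) (b i) v →
      OnRuns n (a j) (b j) u → OnRuns n (a j) (b j) v → i = j)
    (hcov : ∀ u < n, ∃ i j, i ≠ j ∧ (u = a i ∨ u = cycSucc n (a i) ∨ u = b i) ∧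
      (u = a j ∨ u = cycSucc n (a j) ∨ u = b j)) :
    ∃ E : Finset (Finset (Fin n)), (∀ e ∈ E, e.card = 5) ∧ EIh E = cyc n ∧
      E.card = Fintype.card ι ∧ {e : Finset (Fin n) | e ∈ E ∧ ¬ IsSection32 e}.ncard ≤ 2 := by
  let F : ι → Finset (Fin n) := fun i => runs ⟨a i, ha i⟩ ⟨b i, hb i⟩
  have hmem (i : ι) (u : Fin n) : u ∈ F i ↔ OnRuns n (a i) (b i) u.val := mem_runs _ _ _
  have hF (i : ι) : (F i).card = 5 ∧ IsSection32 (F i) :=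
    runs_card_and_isSection32 hn _ _ (hgap i)
  have hinj : Function.Injective F := by
    intro i j hij
    have hsame (u : ℕ) (hu : u < n) (h : OnRuns n (a i) (b i) u) : OnRuns n (a j) (b j) u := by
      rw [← hmem j ⟨u, hu⟩, ← hij, hmem]
      exact h
    have hai : OnRuns n (a i) (b i) (a i) := Or.inl rfl
    have hbi : OnRuns n (a i) (b i) (b i) := Or.inr (Or.inr (Or.inr (Or.inl rfl)))
    have ha' := hsame _ (ha i) hai
    have hb' := hsame _ (hb i) hbi
    have hai' := ha i
    have hbi' := hb i
    rcases hgap i with h | h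
    · exact hlin i j (a i) (b i) (by omega) (hb i) (by omega) hai hbi ha' hb'
    · exact hlin i j (b i) (a i) (by omega) (ha i) (by omega) hbi hai hb' ha'
  have hcover (i : ι) (u : Fin n)
      (h : u.val = a i ∨ u.val = cycSucc n (a i) ∨ u.val = b i) : u ∈ F i ∧ u + 1 ∈ F i := by
    rw [hmem, hmem, fin_val_add_one]
    unfold OnRuns
    rcases h with h | h | h <;> simp [h]
  refine ⟨Finset.univ.map ⟨F, hinj⟩, ?_, EIh_eq_cyc (by omega) _ ?_ ?_, ?_, ?_⟩
  · simp only [Finset.mem_map, Finset.mem_univ, true_and, Function.Embedding.coeFn_mk,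
      forall_exists_index, forall_apply_eq_imp_iff]
    exact fun i => (hF i).1
  · simp only [Finset.mem_map, Finset.mem_univ, true_and, Function.Embedding.coeFn_mk,
      forall_exists_index, forall_apply_eq_imp_iff, hmem]
    exact fun i j u v h1 h2 h3 h4 h5 h6 => congrArg F (hlin i j u v h1 v.isLt h2 h3 h4 h5 h6)
  · intro u
    obtain ⟨i, j, hij, hi, hj⟩ := hcov u u.isLt
    have hi' := hcover i u hi
    have hj' := hcover j u hj
    exact ⟨F i, by simp, F j, by simp, hinj.ne hij, hi'.1, hi'.2, hj'.1, hj'.2⟩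
  · rw [Finset.card_map, Finset.card_univ]
  · have hempty : {e : Finset (Fin n) | e ∈ Finset.univ.map ⟨F, hinj⟩ ∧ ¬ IsSection32 e} = ∅ := by
      ext e
      simp only [Finset.mem_map, Finset.mem_univ, true_and, Function.Embedding.coeFn_mk,
        Set.mem_ofPred_eq, Set.mem_empty_iff_false, iff_false, not_and, not_not]
      rintro ⟨i, rfl⟩
      exact (hF i).2
    rw [hempty, Set.ncard_empty]
    exact Nat.zero_le 2

instance (n a b u : ℕ) : Decidable (OnRuns n a b u) := by unfold OnRuns; infer_instance

set_option synthInstance.maxSize 2000 in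
set_option synthInstance.maxHeartbeats 400000 in
theorem exists_of_eighteen_le_of_le_twenty (n : ℕ) [NeZero n] (hn : 18 ≤ n) (hn' : n ≤ 20) :
    ∃ E : Finset (Finset (Fin n)), (∀ e ∈ E, e.card = 5) ∧ EIh E = cyc n ∧
      E.card = (2 * n + 2) / 3 ∧ {e : Finset (Fin n) | e ∈ E ∧ ¬ IsSection32 e}.ncard ≤ 2 := by
  obtain rfl | rfl | rfl : n = 18 ∨ n = 19 ∨ n = 20 := by omega
  · refine exists_of_runs (n := 18) (ι := Fin 12) (by norm_num)
      ![0, 1, 3, 4, 6, 7, 9, 10, 12, 13, 15, 16]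
      ![8, 15, 17, 14, 12, 3, 5, 2, 0, 9, 11, 6]
      (by decide) (by decide) (by decide) (fun i j u v h1 h2 h3 h4 h5 => ?_) (by decide +kernel)
    have hu : u < v - 1 := by omega
    clear hn hn' h1
    revert j h3
    revert h4
    revert hu
    revert u
    revert h5
    revert h2
    revert i v
    decide +kernel
  · refine exists_of_runs (n := 19) (ι := Fin 13) (by norm_num)
      ![0, 1, 3, 4, 6, 7, 9, 10, 12, 13, 15, 16, 18]
      ![12, 8, 11, 9, 12, 14, 18, 15, 17, 3, 5, 2, 6]
      (by decide) (by decide) (by decide) (fun i j u v h1 h2 h3 h4 h5 => ?_) (by decide +kernel)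
    have hu : u < v - 1 := by omega
    clear hn hn' h1
    revert j h3
    revert h4
    revert hu
    revert u
    revert h5
    revert h2
    revert i v
    decide +kernel
  · refine exists_of_runs (n := 20) (ι := Fin 14) (by norm_num)
      ![0, 1, 3, 4, 6, 7, 9, 10, 12, 13, 15, 16, 18, 19]
      ![12, 8, 12, 9, 11, 18, 13, 15, 17, 6, 2, 5, 3, 14]
      (by decide) (by decide) (by decide) (fun i j u v h1 h2 h3 h4 h5 => ?_) (by decide +kernel)
    have hu : u < v - 1 := by omega
    clear hn hn' h1
    revert j h3
    revert h4
    revert hu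
    revert u
    revert h5
    revert h2
    revert i v
    decide +kernel

/-- The start of the pair of the hyperedge whose triple starts at `3 * m`. -/
def evenPair (k m : ℕ) : ℕ := if m + 2 < k then 3 * m + 6 else 3 * m + 6 - 3 * k

/-- The start of the pair of the hyperedge whose triple starts at `3 * m + 1`. -/
def oddPair (n k m : ℕ) : ℕ :=
  if m + 4 < k then 3 * m + 11 else if m + 4 = k then n - 1 else 3 * m + 11 - 3 * k

/-- The start of the pair of the additional hyperedge whose triple starts at `3 * k - 1 + x`. -/
def seamPair (n k x : ℕ) : ℕ := if n = 3 * k + 1 then 3 * k - 8 else 2 * x + 1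

section

variable {n k m m' x x' u v : ℕ}

theorem OnRuns.of_even (hk : 7 ≤ k) (hn : 3 * k ≤ n) (hm : m < k)
    (h : OnRuns n (3 * m) (evenPair k m) u) :
    (u = 3 * m ∨ u = 3 * m + 1 ∨ u = 3 * m + 2) ∨
      (m + 2 < k ∧ (u = 3 * m + 6 ∨ u = 3 * m + 7)) ∨
      (k ≤ m + 2 ∧ (u + 3 * k = 3 * m + 6 ∨ u + 3 * k = 3 * m + 7)) := by
  unfold OnRuns cycSucc evenPair at h
  grind

theorem OnRuns.of_odd (hk : 7 ≤ k) (hn : 3 * k ≤ n) (hm : m < k)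
    (h : OnRuns n (3 * m + 1) (oddPair n k m) u) :
    (u = 3 * m + 1 ∨ u = 3 * m + 2 ∨ (3 * m + 3 < n ∧ u = 3 * m + 3) ∨
        (3 * m + 3 = n ∧ u = 0)) ∨
      (m + 4 < k ∧ (u = 3 * m + 11 ∨ u = 3 * m + 12)) ∨
      (m + 4 = k ∧ (u + 1 = n ∨ u = 0)) ∨
      (k < m + 4 ∧ (u + 3 * k = 3 * m + 11 ∨ u + 3 * k = 3 * m + 12)) := by
  unfold OnRuns cycSucc oddPair at h
  grind

theorem OnRuns.of_seam (hk : 7 ≤ k) (hn : n ≤ 3 * k + 2) (hx : x < n - 3 * k)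
    (h : OnRuns n (3 * k - 1 + x) (seamPair n k x) u) :
    (n = 3 * k + 1 ∧ x = 0 ∧
        (u + 1 = 3 * k ∨ u = 3 * k ∨ u = 0 ∨ u + 8 = 3 * k ∨ u + 7 = 3 * k)) ∨
      (n = 3 * k + 2 ∧ x = 0 ∧ (u + 1 = 3 * k ∨ u = 3 * k ∨ u = 3 * k + 1 ∨ u = 1 ∨ u = 2)) ∨
      (n = 3 * k + 2 ∧ x = 1 ∧ (u = 3 * k ∨ u = 3 * k + 1 ∨ u = 0 ∨ u = 3 ∨ u = 4)) := by
  unfold OnRuns cycSucc seamPair at h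
  obtain ⟨rfl, rfl⟩ | ⟨rfl, rfl⟩ | ⟨rfl, rfl⟩ :
      n = 3 * k + 1 ∧ x = 0 ∨ n = 3 * k + 2 ∧ x = 0 ∨ n = 3 * k + 2 ∧ x = 1 := by omega
  all_goals grind

theorem eq_of_onRuns_even_even (hk : 7 ≤ k) (hn : 3 * k ≤ n) (hm : m < k) (hm' : m' < k)
    (huv : u + 2 ≤ v)
    (hu : OnRuns n (3 * m) (evenPair k m) u) (hv : OnRuns n (3 * m) (evenPair k m) v)
    (hu' : OnRuns n (3 * m') (evenPair k m') u) (hv' : OnRuns n (3 * m') (evenPair k m') v) :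
    m = m' := by
  replace hv := hv.of_even hk hn hm
  replace hv' := hv'.of_even hk hn hm'
  rcases hu.of_even hk hn hm with h | h | h <;>
    rcases hu'.of_even hk hn hm' with h' | h' | h' <;> omega

theorem not_onRuns_even_odd (hk : 7 ≤ k) (hn : 3 * k ≤ n) (hm : m < k) (hm' : m' < k)
    (huv : u + 2 ≤ v)
    (hu : OnRuns n (3 * m) (evenPair k m) u) (hv : OnRuns n (3 * m) (evenPair k m) v)
    (hu' : OnRuns n (3 * m' + 1) (oddPair n k m') u)
    (hv' : OnRuns n (3 * m' + 1) (oddPair n k m') v) : False := by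
  replace hv := hv.of_even hk hn hm
  replace hv' := hv'.of_odd hk hn hm'
  rcases hu.of_even hk hn hm with h | h | h <;>
    rcases hu'.of_odd hk hn hm' with h' | h' | h' | h' <;> omega

theorem eq_of_onRuns_odd_odd (hk : 7 ≤ k) (hn : 3 * k ≤ n) (hm : m < k) (hm' : m' < k)
    (huv : u + 2 ≤ v) (hw : u = 0 → v + 1 < n)
    (hu : OnRuns n (3 * m + 1) (oddPair n k m) u) (hv : OnRuns n (3 * m + 1) (oddPair n k m) v)
    (hu' : OnRuns n (3 * m' + 1) (oddPair n k m') u)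
    (hv' : OnRuns n (3 * m' + 1) (oddPair n k m') v) : m = m' := by
  replace hv := hv.of_odd hk hn hm
  replace hv' := hv'.of_odd hk hn hm'
  rcases hu.of_odd hk hn hm with h | h | h | h <;>
    rcases hu'.of_odd hk hn hm' with h' | h' | h' | h' <;> omega

theorem not_onRuns_even_seam (hk : 7 ≤ k) (hn : 3 * k ≤ n) (hn' : n ≤ 3 * k + 2) (hm : m < k)
    (hx : x < n - 3 * k) (huv : u + 2 ≤ v)
    (hu : OnRuns n (3 * m) (evenPair k m) u) (hv : OnRuns n (3 * m) (evenPair k m) v)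
    (hu' : OnRuns n (3 * k - 1 + x) (seamPair n k x) u)
    (hv' : OnRuns n (3 * k - 1 + x) (seamPair n k x) v) : False := by
  replace hv := hv.of_even hk hn hm
  replace hv' := hv'.of_seam hk hn' hx
  rcases hu.of_even hk hn hm with h | h | h <;>
    rcases hu'.of_seam hk hn' hx with h' | h' | h' <;> omega

theorem not_onRuns_odd_seam (hk : 7 ≤ k) (hn : 3 * k ≤ n) (hn' : n ≤ 3 * k + 2) (hm : m < k)
    (hx : x < n - 3 * k) (huv : u + 2 ≤ v) (hw : u = 0 → v + 1 < n)
    (hu : OnRuns n (3 * m + 1) (oddPair n k m) u) (hv : OnRuns n (3 * m + 1) (oddPair n k m) v)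
    (hu' : OnRuns n (3 * k - 1 + x) (seamPair n k x) u)
    (hv' : OnRuns n (3 * k - 1 + x) (seamPair n k x) v) : False := by
  replace hv := hv.of_odd hk hn hm
  replace hv' := hv'.of_seam hk hn' hx
  rcases hu.of_odd hk hn hm with h | h | h | h <;>
    rcases hu'.of_seam hk hn' hx with h' | h' | h' <;> omega

theorem eq_of_onRuns_seam_seam (hk : 7 ≤ k) (hn' : n ≤ 3 * k + 2)
    (hx : x < n - 3 * k) (hx' : x' < n - 3 * k) (huv : u + 2 ≤ v)
    (hu : OnRuns n (3 * k - 1 + x) (seamPair n k x) u)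
    (hv : OnRuns n (3 * k - 1 + x) (seamPair n k x) v)
    (hu' : OnRuns n (3 * k - 1 + x') (seamPair n k x') u)
    (hv' : OnRuns n (3 * k - 1 + x') (seamPair n k x') v) : x = x' := by
  replace hu := hu.of_seam hk hn' hx
  replace hv := hv.of_seam hk hn' hx
  replace hu' := hu'.of_seam hk hn' hx'
  replace hv' := hv'.of_seam hk hn' hx'
  omega

end

theorem exists_of_twenty_one_le (n : ℕ) [NeZero n] (hn : 21 ≤ n) :
    ∃ E : Finset (Finset (Fin n)), (∀ e ∈ E, e.card = 5) ∧ EIh E = cyc n ∧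
      E.card = (2 * n + 2) / 3 ∧ {e : Finset (Fin n) | e ∈ E ∧ ¬ IsSection32 e}.ncard ≤ 2 := by
  obtain ⟨k, hk, hkn, hnk⟩ : ∃ k, 7 ≤ k ∧ 3 * k ≤ n ∧ n ≤ 3 * k + 2 := ⟨n / 3, by omega⟩
  have hcard : Fintype.card (Fin k ⊕ Fin k ⊕ Fin (n - 3 * k)) = (2 * n + 2) / 3 := by
    simp only [Fintype.card_sum, Fintype.card_fin]
    omega
  rw [← hcard]
  refine exists_of_runs (by omega)
    (Sum.elim (fun m => 3 * m.val)
      (Sum.elim (fun m => 3 * m.val + 1) fun x => 3 * k - 1 + x.val))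
    (Sum.elim (fun m => evenPair k m)
      (Sum.elim (fun m => oddPair n k m) fun x => seamPair n k x)) ?_ ?_ ?_ ?_ ?_
  · rintro (i | i | i) <;> have hi := i.isLt <;> simp only [Sum.elim_inl, Sum.elim_inr] <;> omega
  · rintro (i | i | i) <;> have hi := i.isLt <;>
      simp only [Sum.elim_inl, Sum.elim_inr, evenPair, oddPair, seamPair] <;> split_ifs <;> omega
  · rintro (i | i | i) <;> have hi := i.isLt <;>
      simp only [Sum.elim_inl, Sum.elim_inr, evenPair, oddPair, seamPair] <;> split_ifs <;> omega
  · rintro (i | i | i) (j | j | j) u v huv - hw hu hv hu' hv'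
    · rw [Fin.ext (eq_of_onRuns_even_even hk hkn i.isLt j.isLt huv hu hv hu' hv')]
    · exact (not_onRuns_even_odd hk hkn i.isLt j.isLt huv hu hv hu' hv').elim
    · exact (not_onRuns_even_seam hk hkn hnk i.isLt j.isLt huv hu hv hu' hv').elim
    · exact (not_onRuns_even_odd hk hkn j.isLt i.isLt huv hu' hv' hu hv).elim
    · rw [Fin.ext (eq_of_onRuns_odd_odd hk hkn i.isLt j.isLt huv hw hu hv hu' hv')]
    · exact (not_onRuns_odd_seam hk hkn hnk i.isLt j.isLt huv hw hu hv hu' hv').elim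
    · exact (not_onRuns_even_seam hk hkn hnk j.isLt i.isLt huv hu' hv' hu hv).elim
    · exact (not_onRuns_odd_seam hk hkn hnk j.isLt i.isLt huv hw hu' hv' hu hv).elim
    · rw [Fin.ext (eq_of_onRuns_seam_seam hk hnk i.isLt j.isLt huv hu hv hu' hv')]
  · intro u hu
    by_cases hlast : u + 1 = n
    · by_cases h0 : n = 3 * k
      · refine ⟨.inr (.inl ⟨k - 1, by omega⟩), .inr (.inl ⟨k - 4, by omega⟩), ?_, ?_, ?_⟩ <;>
          simp only [Sum.elim_inl, Sum.elim_inr, oddPair, cycSucc, ne_eq, Sum.inr.injEq,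
            Sum.inl.injEq, Fin.mk.injEq] <;> grind
      · refine ⟨.inr (.inr ⟨n - 3 * k - 1, by omega⟩), .inr (.inl ⟨k - 4, by omega⟩),
          by simp, ?_, ?_⟩ <;> simp only [Sum.elim_inl, Sum.elim_inr, oddPair, cycSucc] <;> grind
    by_cases hseam : u = 3 * k - 1
    · refine ⟨.inr (.inl ⟨k - 1, by omega⟩), .inr (.inr ⟨0, by omega⟩), by simp, ?_, ?_⟩ <;>
        simp only [Sum.elim_inl, Sum.elim_inr, cycSucc] <;> grind
    by_cases hmid : u = 3 * k
    · refine ⟨.inr (.inr ⟨0, by omega⟩), .inr (.inr ⟨1, by omega⟩), by simp, ?_, ?_⟩ <;>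
        simp only [Sum.elim_inr, cycSucc] <;> grind
    have hu' : u < 3 * k - 1 := by omega
    obtain ⟨m, rfl | rfl | rfl⟩ : ∃ m, u = 3 * m ∨ u = 3 * m + 1 ∨ u = 3 * m + 2 :=
      ⟨u / 3, by omega⟩
    · refine ⟨.inl ⟨m, by omega⟩, .inl ⟨if 2 ≤ m then m - 2 else m + k - 2, by
        split_ifs <;> omega⟩, ?_, ?_, ?_⟩ <;>
        simp only [Sum.elim_inl, evenPair, ne_eq, Sum.inl.injEq, Fin.mk.injEq] <;> grind
    · refine ⟨.inl ⟨m, by omega⟩, .inr (.inl ⟨m, by omega⟩), by simp, ?_, ?_⟩ <;>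
        simp only [Sum.elim_inl, Sum.elim_inr, cycSucc] <;> grind
    · refine ⟨.inr (.inl ⟨m, by omega⟩), .inr (.inl ⟨if 3 ≤ m then m - 3 else m + k - 3, by
        split_ifs <;> omega⟩), ?_, ?_, ?_⟩ <;>
        simp only [Sum.elim_inl, Sum.elim_inr, oddPair, cycSucc, ne_eq, Sum.inr.injEq,
          Sum.inl.injEq, Fin.mk.injEq] <;> grind

theorem stmt_14 (n : ℕ) [NeZero n] (hn : 18 ≤ n) :
    ∃ E : Finset (Finset (Fin n)), (∀ e ∈ E, e.card = 5) ∧ EIh E = cyc n ∧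
      E.card = (2 * n + 2) / 3 ∧ {e : Finset (Fin n) | e ∈ E ∧ ¬ IsSection32 e}.ncard ≤ 2 := by
  rcases Nat.lt_or_ge 20 n with h | h
  · exact exists_of_twenty_one_le n h
  · exact exists_of_eighteen_le_of_le_twenty n hn h
end
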